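/- Let W be a finite-dimensional real inner product space and let J : W → W be a linear isometry with J ∘ J = −id. Let W_ℂ = ℂ ⊗_ℝ W be the complexification of W, regarded as a complex vector space, and let η : W → W_ℂ be the real-linear map η(e) = 1 ⊗ e + i ⊗ (J e). Let B : W × W → ℝ be a real bilinear form satisfying B(Jx, Jy) = B(x, y) for all x, y ∈ W. Then for every orthonormal basis (e₁, …, e_n) of W one has Σ_{i=1}^n Σ_{s=1}^n B(e_i, e_s) · η(e_i) ∧ η(e_s) = 0 in the exterior algebra of W_ℂ over ℂ. -/

import Mathlib

open TensorProduct

open scoped InnerProductSpace in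
/-- The trace of a bilinear map with respect to the inner product does not depend on the
orthonormal basis. -/
theorem OrthonormalBasis.sum_bilin_apply_eq {W M ι κ : Type*} [NormedAddCommGroup W]
    [InnerProductSpace ℝ W] [AddCommGroup M] [Module ℝ M] [Fintype ι] [Fintype κ]
    (e : OrthonormalBasis ι ℝ W) (f : OrthonormalBasis κ ℝ W) (D : W →ₗ[ℝ] W →ₗ[ℝ] M) :
    ∑ i, D (e i) (e i) = ∑ j, D (f j) (f j) := by
  calc ∑ i, D (e i) (e i) = ∑ i, ∑ j, ⟪f j, e i⟫_ℝ • D (e i) (f j) := by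
        refine Finset.sum_congr rfl fun i _ => ?_
        simpa only [map_sum, map_smul] using congrArg (D (e i)) (f.sum_repr' (e i)).symm
    _ = ∑ j, ∑ i, ⟪e i, f j⟫_ℝ • D (e i) (f j) := by
        rw [Finset.sum_comm]
        simp only [real_inner_comm]
    _ = ∑ j, D (f j) (f j) := by
        refine Finset.sum_congr rfl fun j _ => ?_
        conv_rhs => arg 1; rw [← e.sum_repr' (f j)]
        simp only [map_sum, map_smul, LinearMap.sum_apply, LinearMap.smul_apply]

/-- The contraction of a bilinear form with a bilinear map does not depend on the orthonormal
basis. -/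
theorem OrthonormalBasis.sum_sum_bilin_smul_eq {W M ι κ : Type*} [NormedAddCommGroup W]
    [InnerProductSpace ℝ W] [AddCommGroup M] [Module ℝ M] [Fintype ι] [Fintype κ]
    (e : OrthonormalBasis ι ℝ W) (f : OrthonormalBasis κ ℝ W)
    (B : W →ₗ[ℝ] W →ₗ[ℝ] ℝ) (C : W →ₗ[ℝ] W →ₗ[ℝ] M) :
    ∑ i, ∑ s, B (e i) (e s) • C (e i) (e s) = ∑ j, ∑ t, B (f j) (f t) • C (f j) (f t) := by
  have right (x : W) : ∑ s, B x (e s) • C x (e s) = ∑ t, B x (f t) • C x (f t) :=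
    e.sum_bilin_apply_eq f ((LinearMap.lsmul ℝ M).compl₁₂ (B x) (C x))
  have left (y : W) : ∑ i, B (e i) y • C (e i) y = ∑ j, B (f j) y • C (f j) y :=
    e.sum_bilin_apply_eq f ((LinearMap.lsmul ℝ M).compl₁₂ (B.flip y) (C.flip y))
  simp only [right]
  rw [Finset.sum_comm]
  simp only [left]
  rw [Finset.sum_comm]

/-- linear-algebraic content of Lemma 1.7 of the paper. If `J` is a linear
isometry of a finite-dimensional real inner product space `W` with `J² = -1`, `B` is a
real bilinear form with `B (J x) (J y) = B x y`, and `η e = 1 ⊗ e + i ⊗ (J e)` in the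
complexification `ℂ ⊗[ℝ] W`, then for every orthonormal basis `(e i)` of `W`,
`∑ i, ∑ s, B (e i) (e s) • η (e i) ∧ η (e s) = 0` in the exterior algebra of `ℂ ⊗[ℝ] W`. -/
theorem stmt3 {W : Type*} [NormedAddCommGroup W] [InnerProductSpace ℝ W]
    [FiniteDimensional ℝ W]
    (J : W →ₗ[ℝ] W) (hJiso : ∀ x : W, ‖J x‖ = ‖x‖) (hJ2 : J ∘ₗ J = -LinearMap.id)
    (B : W →ₗ[ℝ] W →ₗ[ℝ] ℝ) (hB : ∀ x y : W, B (J x) (J y) = B x y)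
    (n : ℕ) (e : OrthonormalBasis (Fin n) ℝ W) :
    ∑ i : Fin n, ∑ s : Fin n, ((B (e i) (e s) : ℝ) : ℂ) •
      (ExteriorAlgebra.ι ℂ ((1 : ℂ) ⊗ₜ[ℝ] (e i) + Complex.I ⊗ₜ[ℝ] (J (e i))) *
       ExteriorAlgebra.ι ℂ ((1 : ℂ) ⊗ₜ[ℝ] (e s) + Complex.I ⊗ₜ[ℝ] (J (e s)))) = 0 := by
  have hJJ (x : W) : J (J x) = -x := LinearMap.congr_fun hJ2 x
  let Je : W ≃ₗᵢ[ℝ] W :=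
    ⟨LinearEquiv.ofLinearMap J (-J) (by ext x; simp [hJJ]) (by ext x; simp [hJJ]), hJiso⟩
  let η : W →ₗ[ℝ] ℂ ⊗[ℝ] W := TensorProduct.mk ℝ ℂ W 1 + TensorProduct.mk ℝ ℂ W Complex.I ∘ₗ J
  have hη (x : W) : η (J x) = (-Complex.I) • η x := by
    simp [η, hJJ, TensorProduct.smul_tmul', TensorProduct.tmul_neg, TensorProduct.neg_tmul,
      add_comm]
  let w : W →ₗ[ℝ] ExteriorAlgebra ℂ (ℂ ⊗[ℝ] W) := (ExteriorAlgebra.ι ℂ).restrictScalars ℝ ∘ₗ η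
  have hw (x : W) : w (J x) = (-Complex.I) • w x := by
    simp only [w, LinearMap.comp_apply, LinearMap.restrictScalars_apply, hη, map_smul]
  let C := (LinearMap.mul ℝ (ExteriorAlgebra ℂ (ℂ ⊗[ℝ] W))).compl₁₂ w w
  have hC (x y : W) : C (J x) (J y) = -C x y := by
    simp [C, hw, smul_smul]
  have key := e.sum_sum_bilin_smul_eq (e.map Je) B C
  have hJe (i : Fin n) : e.map Je i = J (e i) := rfl
  simp only [hJe, hB, hC, smul_neg, Finset.sum_neg_distrib] at key
  simp only [Complex.coe_smul]
  change ∑ i, ∑ s, B (e i) (e s) • C (e i) (e s) = 0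
  rw [← smul_eq_zero_iff_right (two_ne_zero (α := ℝ)), two_smul]
  exact eq_neg_iff_add_eq_zero.mp key
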